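/- arXiv:1305.3850 — 2 statements merged into one kernel-verified Lean document; each statement's English description precedes it below -/
import Mathlib

section
/- Let q ∈ ((1+√5)/2, q_f], where q_f ≈ 1.75488 is the unique root in (1,2) of x³ = 2x² − x + 1. Then the set U_q of points of I_q with a unique q-expansion equals {(0^k (10)^∞)_q : k ≥ 0} ∪ {(1^k (10)^∞)_q : k ≥ 0} ∪ {0, 1/(q−1)}. -/
noncomputable section

open Set

/-- The map `T_{q,i}(x) = q*x - i` for a binary digit `i`. -/
def Tmap (q : ℝ) (i : Fin 2) (x : ℝ) : ℝ := q * x - ((i : ℕ) : ℝ)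

/-- The value `((ε_i)_{i=1}^∞)_q = ∑_{i=1}^∞ ε_i q^{-i}` of a binary sequence in base `q`
(the sequence is 0-indexed, so digit `ε i` has weight `q^{-(i+1)}`). -/
def seqVal (q : ℝ) (ε : ℕ → Fin 2) : ℝ := ∑' i : ℕ, ((ε i : ℕ) : ℝ) / q ^ (i + 1)

/-- `Σ_q(x)`: the set of `q`-expansions of `x`. -/
def SigmaSet (q x : ℝ) : Set (ℕ → Fin 2) := {ε | x = seqVal q ε}

/-- The interval `I_q = [0, 1/(q-1)]`. -/
def Iq (q : ℝ) : Set ℝ := Icc 0 (1 / (q - 1))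

/-- The switch region `S_q = [1/q, 1/(q(q-1))]`. -/
def Sq (q : ℝ) : Set ℝ := Icc (1 / q) (1 / (q * (q - 1)))

/-- The interval `J_q = [(q+q²)/(q⁴-1), (1+q³)/(q⁴-1)]`. -/
def Jq (q : ℝ) : Set ℝ := Icc ((q + q ^ 2) / (q ^ 4 - 1)) ((1 + q ^ 3) / (q ^ 4 - 1))

/-- Apply the first `n` maps of a sequence of maps to `x`:
`applySeq a n x = (a_{n-1} ∘ ⋯ ∘ a_0)(x)`. -/
def applySeq (a : ℕ → ℝ → ℝ) (n : ℕ) (x : ℝ) : ℝ := (List.range n).foldl (fun y k => a k y) x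

/-- `Ω_q(x)`: the set of sequences of maps, each equal to `T_{q,0}` or `T_{q,1}`,
all of whose partial compositions applied to `x` stay in `I_q`. -/
def OmegaSet (q x : ℝ) : Set (ℕ → ℝ → ℝ) :=
  {a | (∀ n, a n = Tmap q 0 ∨ a n = Tmap q 1) ∧ ∀ n : ℕ, applySeq a (n + 1) x ∈ Iq q}

/-- Apply a finite word of digits to `x` (first letter applied first):
for `a = [a₁, …, aₙ]`, `wordMap q a x = (T_{q,aₙ} ∘ ⋯ ∘ T_{q,a₁})(x)`. -/
def wordMap (q : ℝ) (a : List (Fin 2)) (x : ℝ) : ℝ := a.foldl (fun y i => Tmap q i y) x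

/-- A branching sequence for `x`: a finite word whose partial compositions applied to `x`
stay in `I_q`, and whose full composition maps `x` into the switch region `S_q`. -/
def IsBranching (q x : ℝ) (a : List (Fin 2)) : Prop :=
  (∀ k, k ≤ a.length → wordMap q (a.take k) x ∈ Iq q) ∧ wordMap q a x ∈ Sq q

/-- `x` is a `q` null infinite point: `x ∈ (0,1/(q-1))`, `Ω_q(x)` is infinite, and for every
branching sequence `a` for `x` there is a digit `i` with `Ω_q(T_{q,i}(a(x)))` finite. -/
def NullInfinite (q x : ℝ) : Prop :=
  x ∈ Ioo 0 (1 / (q - 1)) ∧ (OmegaSet q x).Infinite ∧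
    ∀ a : List (Fin 2), IsBranching q x a →
      ∃ i : Fin 2, (OmegaSet q (Tmap q i (wordMap q a x))).Finite

/-- `U_q`: points of `I_q` with exactly one `q`-expansion. -/
def UniqSet (q : ℝ) : Set ℝ := {x | x ∈ Iq q ∧ ∃! ε : ℕ → Fin 2, ε ∈ SigmaSet q x}

/-- `B_{ℵ₀}`: bases `q ∈ (1,2)` for which some `x ∈ (0,1/(q-1))` has exactly countably
infinitely many `q`-expansions. -/
def BAleph0 : Set ℝ :=
  {q | q ∈ Ioo (1 : ℝ) 2 ∧ ∃ x ∈ Ioo (0 : ℝ) (1 / (q - 1)),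
    Cardinal.mk ↥(SigmaSet q x) = Cardinal.aleph0}

/-- The eventually periodic binary sequence `u w^∞`: the finite word `u` followed by
infinitely many repetitions of the finite word `w`. -/
def uwInf (u w : List (Fin 2)) : ℕ → Fin 2 := fun i =>
  if i < u.length then u.getD i 0 else w.getD ((i - u.length) % w.length) 0

/-- Prepend a digit to a binary sequence. -/
def digitCons (a : Fin 2) (ε : ℕ → Fin 2) : ℕ → Fin 2
  | 0 => a
  | i + 1 => ε i

/-- Any change of digit is immediately followed by another one. -/
def EventuallyAlternating (ε : ℕ → Fin 2) : Prop :=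
  ∀ n, ε n ≠ ε (n + 1) → ε (n + 2) ≠ ε (n + 1)

/-- No tail of `ε` has its value in the switch region `S_q`. -/
def AvoidsSwitch (q : ℝ) (ε : ℕ → Fin 2) : Prop :=
  ∀ n, (ε n = 0 → seqVal q (fun i => ε (i + n)) < 1 / q) ∧
    (ε n = 1 → 1 / (q * (q - 1)) < seqVal q (fun i => ε (i + n)))

lemma digit_eq_zero_or_one (a : Fin 2) : a = 0 ∨ a = 1 := by omega

lemma digit_le_one (a : Fin 2) : ((a : ℕ) : ℝ) ≤ 1 := by
  rcases digit_eq_zero_or_one a with rfl | rfl <;> simp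

lemma hasSum_geometric_digits {q : ℝ} (hq : 1 < q) :
    HasSum (fun i : ℕ => 1 / q ^ (i + 1)) (1 / (q - 1)) := by
  have h := (hasSum_geometric_of_lt_one (r := q⁻¹) (by positivity)
    (inv_lt_one_of_one_lt₀ hq)).mul_left q⁻¹
  have h1 : q - 1 ≠ 0 := by linarith
  have h2 : q ≠ 0 := by linarith
  have hterm : (fun i : ℕ => 1 / q ^ (i + 1)) = fun i => q⁻¹ * q⁻¹ ^ i := by
    ext i
    rw [← pow_succ', inv_pow, one_div]
  have hval : 1 / (q - 1) = q⁻¹ * (1 - q⁻¹)⁻¹ := by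
    have : (1 - q⁻¹) = (q - 1) / q := by field_simp
    rw [this]
    field_simp
  rwa [hterm, hval]

lemma summable_digits {q : ℝ} (hq : 1 < q) (ε : ℕ → Fin 2) :
    Summable (fun i : ℕ => ((ε i : ℕ) : ℝ) / q ^ (i + 1)) := by
  have hq0 : 0 < q := by linarith
  refine Summable.of_nonneg_of_le (fun i => by positivity) (fun i => ?_)
    (hasSum_geometric_digits hq).summable
  gcongr
  exact digit_le_one _

lemma seqVal_nonneg {q : ℝ} (hq : 1 < q) (ε : ℕ → Fin 2) : 0 ≤ seqVal q ε := by
  have hq0 : 0 < q := by linarith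
  exact tsum_nonneg fun i => by positivity

lemma seqVal_compl {q : ℝ} (hq : 1 < q) (ε : ℕ → Fin 2) :
    seqVal q (fun i => 1 - ε i) = 1 / (q - 1) - seqVal q ε := by
  have h := (hasSum_geometric_digits hq).sub (summable_digits hq ε).hasSum
  rw [seqVal, seqVal, ← h.tsum_eq]
  congr 1
  ext i
  rcases digit_eq_zero_or_one (ε i) with h | h <;> simp [h]

lemma seqVal_le {q : ℝ} (hq : 1 < q) (ε : ℕ → Fin 2) : seqVal q ε ≤ 1 / (q - 1) := by
  have := seqVal_nonneg hq (fun i => 1 - ε i)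
  rw [seqVal_compl hq] at this
  linarith

lemma seqVal_mem_Iq {q : ℝ} (hq : 1 < q) (ε : ℕ → Fin 2) : seqVal q ε ∈ Iq q :=
  ⟨seqVal_nonneg hq ε, seqVal_le hq ε⟩

lemma seqVal_tail {q : ℝ} (hq : 1 < q) (ε : ℕ → Fin 2) :
    seqVal q (fun i => ε (i + 1)) = q * seqVal q ε - ((ε 0 : ℕ) : ℝ) := by
  have hq0 : q ≠ 0 := by linarith
  rw [seqVal, seqVal, (summable_digits hq ε).tsum_eq_zero_add, mul_add, ← tsum_mul_left]
  have : q * (((ε 0 : ℕ) : ℝ) / q ^ (0 + 1)) = ((ε 0 : ℕ) : ℝ) := by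
    field_simp
    ring
  rw [this, add_sub_cancel_left]
  congr 1
  ext i
  field_simp
  ring

lemma seqVal_shift_succ {q : ℝ} (hq : 1 < q) (ε : ℕ → Fin 2) (n : ℕ) :
    seqVal q (fun i => ε (i + (n + 1))) =
      q * seqVal q (fun i => ε (i + n)) - ((ε n : ℕ) : ℝ) := by
  have h := seqVal_tail hq (fun i => ε (i + n))
  simp only [zero_add] at h
  rw [← h]
  congr 1
  ext i
  congr 2
  ring

lemma seqVal_digitCons {q : ℝ} (hq : 1 < q) (a : Fin 2) (ε : ℕ → Fin 2) :
    seqVal q (digitCons a ε) = (((a : ℕ) : ℝ) + seqVal q ε) / q := by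
  have h := seqVal_tail hq (digitCons a ε)
  have h1 : (fun i => digitCons a ε (i + 1)) = ε := rfl
  have h2 : digitCons a ε 0 = a := rfl
  rw [h1, h2] at h
  have hq0 : q ≠ 0 := by linarith
  field_simp
  linarith

lemma seqVal_eq_of_bounded_orbit {q : ℝ} (hq : 1 < q) (ε : ℕ → Fin 2) (y : ℕ → ℝ)
    (hy : ∀ n, y n ∈ Iq q) (hstep : ∀ n, y (n + 1) = q * y n - ((ε n : ℕ) : ℝ)) :
    seqVal q ε = y 0 := by
  have hq0 : 0 < q := by linarith
  have hsum : ∀ n, ∑ i ∈ Finset.range n, ((ε i : ℕ) : ℝ) / q ^ (i + 1) = y 0 - y n / q ^ n := by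
    intro n
    induction n with
    | zero => simp
    | succ n ih =>
      rw [Finset.sum_range_succ, ih, hstep]
      field_simp
      ring
  have hlim : Filter.Tendsto (fun n => y n / q ^ n) Filter.atTop (nhds 0) := by
    have hgeom : Filter.Tendsto (fun n : ℕ => 1 / (q - 1) * (q⁻¹) ^ n) Filter.atTop (nhds 0) := by
      simpa using (tendsto_pow_atTop_nhds_zero_of_lt_one (r := q⁻¹) (by positivity)
        (inv_lt_one_of_one_lt₀ hq)).const_mul (1 / (q - 1))
    refine squeeze_zero (fun n => div_nonneg (hy n).1 (by positivity)) (fun n => ?_) hgeom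
    rw [inv_pow, ← div_eq_mul_inv]
    exact div_le_div_of_nonneg_right (hy n).2 (by positivity)
  have h1 := (summable_digits hq ε).hasSum.tendsto_sum_nat
  have h2 := hlim.const_sub (y 0)
  simp only [hsum, sub_zero] at h1 h2
  exact tendsto_nhds_unique h1 h2

lemma exists_seqVal_eq {q : ℝ} (hq : 1 < q) (hq2 : q < 2) {x : ℝ} (hx : x ∈ Iq q) :
    ∃ ε, seqVal q ε = x := by
  classical
  let d : ℝ → Fin 2 := fun y => if 1 ≤ q * y then 1 else 0
  let y : ℕ → ℝ := fun n => (fun z => q * z - ((d z : ℕ) : ℝ))^[n] x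
  have hstep : ∀ n, y (n + 1) = q * y n - ((d (y n) : ℕ) : ℝ) := fun n =>
    Function.iterate_succ_apply' _ n x
  have hM : q * (1 / (q - 1)) - 1 = 1 / (q - 1) := by
    have : q - 1 ≠ 0 := by linarith
    field_simp
    ring
  have hM1 : 1 ≤ 1 / (q - 1) := by
    rw [le_div_iff₀ (by linarith)]
    linarith
  refine ⟨fun n => d (y n), seqVal_eq_of_bounded_orbit hq _ y (fun n => ?_) hstep⟩
  induction n with
  | zero => exact hx
  | succ n ih =>
    obtain ⟨h0, h1⟩ := ih
    have hle : q * y n ≤ q * (1 / (q - 1)) := by gcongr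
    have hnn : 0 ≤ q * y n := mul_nonneg (by linarith) h0
    rw [hstep]
    by_cases h : 1 ≤ q * y n
    · have hd : d (y n) = 1 := if_pos h
      rw [hd]
      constructor <;> norm_num <;> norm_num at hle hM <;> linarith
    · have hd : d (y n) = 0 := if_neg h
      rw [hd]
      push Not at h
      constructor <;> norm_num <;> norm_num at hM1 <;> linarith

lemma AvoidsSwitch.unique {q : ℝ} (hq : 1 < q) {ε ε' : ℕ → Fin 2} (h : AvoidsSwitch q ε)
    (heq : seqVal q ε' = seqVal q ε) : ε' = ε := by
  have hq0 : 0 < q := by linarith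
  have hM : 1 / (q * (q - 1)) = 1 / (q - 1) / q := by rw [div_div, mul_comm]
  have hdigit : ∀ n, seqVal q (fun i => ε' (i + n)) = seqVal q (fun i => ε (i + n)) →
      ε' n = ε n := by
    intro n hn
    have hs := seqVal_shift_succ hq ε' n
    have h0 := seqVal_nonneg hq (fun i => ε' (i + (n + 1)))
    have h1 := seqVal_le hq (fun i => ε' (i + (n + 1)))
    rw [hs, hn] at h0 h1
    obtain ⟨hz, ho⟩ := h n
    rcases digit_eq_zero_or_one (ε n) with e | e <;>
      rcases digit_eq_zero_or_one (ε' n) with e' | e' <;> rw [e, e']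
    · have := hz e
      rw [lt_div_iff₀ hq0] at this
      simp [e'] at h0
      linarith
    · have := ho e
      rw [hM, div_lt_iff₀ hq0] at this
      rw [e', Fin.val_zero, Nat.cast_zero] at h1
      linarith
  have hval : ∀ n, seqVal q (fun i => ε' (i + n)) = seqVal q (fun i => ε (i + n)) := by
    intro n
    induction n with
    | zero => exact heq
    | succ n ih => rw [seqVal_shift_succ hq, seqVal_shift_succ hq, ih, hdigit n ih]
  exact funext fun n => hdigit n (hval n)

lemma avoidsSwitch_of_unique {q : ℝ} (hq : 1 < q) (hq2 : q < 2) {ε : ℕ → Fin 2}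
    (h : ∀ ε', seqVal q ε' = seqVal q ε → ε' = ε) : AvoidsSwitch q ε := by
  have hq0 : 0 < q := by linarith
  have hM : 1 / (q * (q - 1)) = 1 / (q - 1) / q := by rw [div_div, mul_comm]
  have hMq : q * (1 / (q - 1)) - 1 = 1 / (q - 1) := by
    have : q - 1 ≠ 0 := by linarith
    field_simp
    ring
  have hshift : ∀ n, ∀ ε', seqVal q ε' = seqVal q (fun i => ε (i + n)) →
      ε' = fun i => ε (i + n) := by
    intro n
    induction n with
    | zero => exact h
    | succ n ih =>
      intro ε' hε'
      have := ih (digitCons (ε n) ε') (by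
        rw [seqVal_digitCons hq, hε', seqVal_shift_succ hq]
        field_simp
        ring)
      ext i
      have hi := congrFun this (i + 1)
      change ε' i = _ at hi
      rw [hi]
      congr 2
      ring
  have hother : ∀ (n : ℕ) (a : Fin 2), q * seqVal q (fun i => ε (i + n)) - ((a : ℕ) : ℝ) ∈ Iq q → ε n = a := by
    intro n a ha
    obtain ⟨δ, hδ⟩ := exists_seqVal_eq hq hq2 ha
    have := hshift n (digitCons a δ) (by
      rw [seqVal_digitCons hq, hδ]
      field_simp
      ring)
    have h0 := congrFun this 0
    change a = _ at h0
    rw [h0, zero_add]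
  intro n
  have hle := mul_le_mul_of_nonneg_left (seqVal_le hq (fun i => ε (i + n))) hq0.le
  have hnn := mul_nonneg hq0.le (seqVal_nonneg hq (fun i => ε (i + n)))
  constructor
  · intro e
    by_contra! hc
    rw [div_le_iff₀ hq0] at hc
    have := hother n 1 (by
      rw [Fin.val_one, Nat.cast_one]
      constructor <;> linarith)
    simp [e] at this
  · intro e
    by_contra! hc
    rw [hM, le_div_iff₀ hq0] at hc
    have := hother n 0 (by
      rw [Fin.val_zero, Nat.cast_zero]
      constructor <;> linarith)
    simp [e] at this

lemma mem_uniqSet_iff {q : ℝ} (hq : 1 < q) (hq2 : q < 2) {x : ℝ} :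
    x ∈ UniqSet q ↔ ∃ ε, AvoidsSwitch q ε ∧ x = seqVal q ε := by
  constructor
  · rintro ⟨-, ε, hε, huniq⟩
    have hx : x = seqVal q ε := hε
    exact ⟨ε, avoidsSwitch_of_unique hq hq2 fun ε' h' => huniq ε' (hx.trans h'.symm), hx⟩
  · rintro ⟨ε, hε, rfl⟩
    exact ⟨seqVal_mem_Iq hq ε, ε, rfl, fun ε' (h' : _ = _) => hε.unique hq h'.symm⟩

lemma EventuallyAlternating.compl {ε : ℕ → Fin 2} (h : EventuallyAlternating ε) :
    EventuallyAlternating (fun i => 1 - ε i) := by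
  intro n
  have := h n
  simp only
  omega

lemma EventuallyAlternating.shift {ε : ℕ → Fin 2} (h : EventuallyAlternating ε) (n : ℕ) :
    EventuallyAlternating (fun i => ε (i + n)) := by
  intro m
  have := h (m + n)
  rw [add_right_comm m n 1, add_right_comm m n 2] at this
  exact this

lemma EventuallyAlternating.seqVal_le_of_zero {q : ℝ} (hq : 1 < q) {ε : ℕ → Fin 2}
    (h : EventuallyAlternating ε) (h0 : ε 0 = 0) : seqVal q ε ≤ 1 / (q ^ 2 - 1) := by
  have hq0 : 0 < q := by linarith
  have hB : 0 < 1 / (q ^ 2 - 1) := one_div_pos.mpr (by nlinarith)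
  have hBq : (1 + 1 / (q ^ 2 - 1)) / q ^ 2 = 1 / (q ^ 2 - 1) := by
    have : q ^ 2 - 1 ≠ 0 := by nlinarith
    field_simp
    ring
  have hpeel : ∀ (δ : ℕ → Fin 2) (n : ℕ),
      ∑ i ∈ Finset.range (n + 1), ((δ i : ℕ) : ℝ) / q ^ (i + 1) =
        (((δ 0 : ℕ) : ℝ) +
          ∑ i ∈ Finset.range n, ((δ (i + 1) : ℕ) : ℝ) / q ^ (i + 1)) / q := by
    intro δ n
    rw [Finset.sum_range_succ', add_div, Finset.sum_div, zero_add, pow_one, add_comm]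
    congr 1
    refine Finset.sum_congr rfl fun i _ => ?_
    field_simp
    ring
  have hpart : ∀ (n : ℕ) (δ : ℕ → Fin 2), EventuallyAlternating δ → δ 0 = 0 →
      ∑ i ∈ Finset.range n, ((δ i : ℕ) : ℝ) / q ^ (i + 1) ≤ 1 / (q ^ 2 - 1) := by
    intro n
    induction n using Nat.strong_induction_on with
    | _ n ih =>
      intro δ hδ hδ0
      match n with
      | 0 => simpa using hB.le
      | 1 => simpa [hδ0] using hB.le
      | n + 2 =>
        rcases digit_eq_zero_or_one (δ 1) with h1 | h1
        · have := ih (n + 1) (by omega) (fun i => δ (i + 1)) (hδ.shift 1) h1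
          rw [hpeel, hδ0, Fin.val_zero, Nat.cast_zero, zero_add, div_le_iff₀ hq0]
          nlinarith
        · have h2 : δ 2 = 0 := by
            have := hδ 0
            simp only [zero_add] at this
            omega
          have := ih n (by omega) (fun i => δ (i + 2)) (hδ.shift 2) h2
          rw [hpeel, hpeel (fun i => δ (i + 1)), hδ0, ← hBq]
          simp only [zero_add, h1, Fin.val_zero, Nat.cast_zero, Fin.val_one, Nat.cast_one,
            div_div, ← sq]
          gcongr
  exact (summable_digits hq ε).tsum_le_of_sum_range_le fun n => hpart n ε h h0

lemma EventuallyAlternating.avoidsSwitch {q : ℝ} (hq : 1 < q) (hgold : q + 1 < q ^ 2)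
    {ε : ℕ → Fin 2} (h : EventuallyAlternating ε) : AvoidsSwitch q ε := by
  have hlt : 1 / (q ^ 2 - 1) < 1 / q := by
    apply one_div_lt_one_div_of_lt <;> linarith
  intro n
  constructor
  · intro e
    exact ((h.shift n).seqVal_le_of_zero hq (by simpa using e)).trans_lt hlt
  · intro e
    have := ((h.shift n).compl.seqVal_le_of_zero hq (by simp [e])).trans_lt hlt
    rw [seqVal_compl hq] at this
    have hM : 1 / (q * (q - 1)) = 1 / (q - 1) - 1 / q := by
      have h1 : q - 1 ≠ 0 := by linarith
      have h2 : q ≠ 0 := by linarith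
      field_simp
      ring
    rw [hM]
    linarith

lemma AvoidsSwitch.eventuallyAlternating {q : ℝ} (hq : 1 < q)
    (hqf : q ^ 3 ≤ 2 * q ^ 2 - q + 1) {ε : ℕ → Fin 2} (h : AvoidsSwitch q ε) :
    EventuallyAlternating ε := by
  have hq0 : 0 < q := by linarith
  have hM : 1 / (q * (q - 1)) = 1 / (q - 1) / q := by rw [div_div, mul_comm]
  set M := 1 / (q - 1) with hMdef
  have hMq : M * (q - 1) = 1 := by
    have : q - 1 ≠ 0 := by linarith
    rw [hMdef]
    field_simp
  have hcrit : q ^ 2 - q - 1 ≤ M - 1 := by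
    have : q ^ 2 - q ≤ M := by
      rw [hMdef, le_div_iff₀ (by linarith)]
      nlinarith
    linarith
  intro n hne heq
  have s0 := seqVal_shift_succ hq ε n
  have s1 := seqVal_shift_succ hq ε (n + 1)
  have s2 := seqVal_shift_succ hq ε (n + 2)
  obtain ⟨hz0, ho0⟩ := h n
  obtain ⟨hz2, ho2⟩ := h (n + 2)
  rw [lt_div_iff₀ hq0] at hz0 hz2
  rw [hM, div_lt_iff₀ hq0] at ho0 ho2
  rcases digit_eq_zero_or_one (ε n) with e | e
  · have e1 : ε (n + 1) = 1 := by omega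
    have e2 : ε (n + 2) = 1 := by omega
    have a := hz0 e
    have b := ho2 e2
    simp only [e, e1, e2, Fin.val_zero, Fin.val_one, Nat.cast_zero, Nat.cast_one] at s0 s1 s2
    rw [s1, s0] at b
    nlinarith [mul_pos hq0 hq0]
  · have e1 : ε (n + 1) = 0 := by omega
    have e2 : ε (n + 2) = 0 := by omega
    have a := ho0 e
    have b := hz2 e2
    simp only [e, e1, e2, Fin.val_zero, Fin.val_one, Nat.cast_zero, Nat.cast_one] at s0 s1 s2
    rw [s1, s0] at b
    nlinarith [mul_pos hq0 hq0, mul_lt_mul_of_pos_left a (mul_pos hq0 hq0)]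

lemma uwInf_replicate (k : ℕ) (a : Fin 2) (i : ℕ) :
    uwInf (List.replicate k a) [1, 0] i = if i < k then a else if (i - k) % 2 = 0 then 1 else 0 := by
  unfold uwInf
  simp only [List.length_replicate, List.length_cons, List.length_nil]
  split_ifs with h1 h2
  · simp [List.getD, h1]
  · simp [h2]
  · have : (i - k) % 2 = 1 := by omega
    simp [this]

lemma eventuallyAlternating_uwInf (k : ℕ) (a : Fin 2) :
    EventuallyAlternating (uwInf (List.replicate k a) [1, 0]) := by
  intro n
  simp only [uwInf_replicate]
  split_ifs <;> omega

lemma EventuallyAlternating.classification {ε : ℕ → Fin 2} (h : EventuallyAlternating ε) :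
    (∃ k, ε = uwInf (List.replicate k 0) [1, 0]) ∨ (∃ k, ε = uwInf (List.replicate k 1) [1, 0]) ∨
      ε = (fun _ => 0) ∨ ε = (fun _ => 1) := by
  classical
  by_cases hex : ∃ n, ε n ≠ ε (n + 1)
  · obtain ⟨k, hk, hmin⟩ : ∃ k, ε k ≠ ε (k + 1) ∧ ∀ m < k, ε m = ε (m + 1) :=
      ⟨Nat.find hex, Nat.find_spec hex, fun m hm => not_not.mp (Nat.find_min hex hm)⟩
    have hconst : ∀ m ≤ k, ε m = ε 0 := by
      intro m
      induction m with
      | zero => simp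
      | succ m ih =>
        intro hm
        rw [← hmin m (by omega), ih (by omega)]
    have halt : ∀ j, ε (k + j) ≠ ε (k + j + 1) := by
      intro j
      induction j with
      | zero => exact hk
      | succ j ih => exact (h _ ih).symm
    have htail : ∀ s, k ≤ s → ε s = 1 → ∀ j, ε (s + j) = if j % 2 = 0 then 1 else 0 := by
      intro s hs h1 j
      induction j with
      | zero => simpa using h1
      | succ j ih =>
        have := halt (s + j - k)
        rw [show k + (s + j - k) = s + j by omega, ih] at this
        rw [← add_assoc]
        split_ifs at this ⊢ <;> omega
    have hform : ∀ s a, k ≤ s → ε s = 1 → (∀ i < s, ε i = a) →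
        ε = uwInf (List.replicate s a) [1, 0] := by
      intro s a hs h1 ha
      funext i
      rw [uwInf_replicate]
      split_ifs with hi hp <;> first
        | exact ha i hi
        | (have := htail s hs h1 (i - s)
           rw [show s + (i - s) = i by omega] at this
           simpa [hp] using this)
    have hkk := hconst k le_rfl
    rcases digit_eq_zero_or_one (ε 0) with e | e
    · refine Or.inl ⟨k + 1, hform _ _ (by omega) (by omega) fun i hi => ?_⟩
      rw [hconst i (by omega), e]
    · refine Or.inr (Or.inl ⟨k, hform _ _ le_rfl (by omega) fun i hi => ?_⟩)
      rw [hconst i (by omega), e]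
  · push Not at hex
    have hconst : ε = fun _ => ε 0 := by
      funext n
      induction n with
      | zero => rfl
      | succ n ih => rw [← hex n, ih]
    rcases digit_eq_zero_or_one (ε 0) with e | e <;> rw [e] at hconst <;> simp [hconst]

lemma seqVal_zero (q : ℝ) : seqVal q (fun _ => 0) = 0 := by simp [seqVal]

lemma seqVal_one {q : ℝ} (hq : 1 < q) : seqVal q (fun _ => 1) = 1 / (q - 1) := by
  simpa [seqVal] using (hasSum_geometric_digits hq).tsum_eq

/-- For `q ∈ ((1+√5)/2, q_f]`, the set `U_q` of points of `I_q` with a unique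
`q`-expansion is `{(0^k(10)^∞)_q : k ≥ 0} ∪ {(1^k(10)^∞)_q : k ≥ 0} ∪ {0, 1/(q-1)}`. -/
theorem unique_expansion_set_up_to_qf
    (qf : ℝ) (hqf1 : qf ∈ Set.Ioo (1 : ℝ) 2) (hqf2 : qf ^ 3 = 2 * qf ^ 2 - qf + 1)
    (q : ℝ) (hq : q ∈ Set.Ioc ((1 + Real.sqrt 5) / 2) qf) :
    UniqSet q =
      {x | ∃ k : ℕ, x = seqVal q (uwInf (List.replicate k 0) [1, 0])} ∪
      {x | ∃ k : ℕ, x = seqVal q (uwInf (List.replicate k 1) [1, 0])} ∪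
      {0, 1 / (q - 1)} := by
  obtain ⟨hgold, hle⟩ := hq
  have h5 : Real.sqrt 5 ^ 2 = 5 := Real.sq_sqrt (by norm_num)
  have h5' : 1 < Real.sqrt 5 := by
    rw [Real.lt_sqrt] <;> norm_num
  have hq1 : 1 < q := by linarith
  have hq2 : q < 2 := hle.trans_lt hqf1.2
  have hgold' : q + 1 < q ^ 2 := by nlinarith
  have hcubic : q ^ 3 ≤ 2 * q ^ 2 - q + 1 := by
    have hf : 0 ≤ (qf - 1) ^ 2 + (q - 1) ^ 2 + (qf * q - 1) := by
      nlinarith [sq_nonneg (qf - 1), sq_nonneg (q - 1), hqf1.1]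
    nlinarith [mul_nonneg (sub_nonneg.mpr hle) hf]
  ext x
  rw [mem_uniqSet_iff hq1 hq2]
  constructor
  · rintro ⟨ε, hε, rfl⟩
    rcases (hε.eventuallyAlternating hq1 hcubic).classification with
      ⟨k, rfl⟩ | ⟨k, rfl⟩ | rfl | rfl
    · exact Or.inl (Or.inl ⟨k, rfl⟩)
    · exact Or.inl (Or.inr ⟨k, rfl⟩)
    · exact Or.inr (Or.inl (seqVal_zero q))
    · exact Or.inr (Or.inr (seqVal_one hq1))
  · rintro ((⟨k, rfl⟩ | ⟨k, rfl⟩) | rfl | rfl)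
    · exact ⟨_, (eventuallyAlternating_uwInf k 0).avoidsSwitch hq1 hgold', rfl⟩
    · exact ⟨_, (eventuallyAlternating_uwInf k 1).avoidsSwitch hq1 hgold', rfl⟩
    · exact ⟨_, EventuallyAlternating.avoidsSwitch hq1 hgold' (by simp [EventuallyAlternating]),
        (seqVal_zero q).symm⟩
    · exact ⟨_, EventuallyAlternating.avoidsSwitch hq1 hgold' (by simp [EventuallyAlternating]),
        (seqVal_one hq1).symm⟩
end
end

section
/- For all q ∈ ((1+√5)/2, q_{ℵ₀}) the following hold: (1) T_{q,0}^{−1}((01(10)^∞)_q) + 1 ∈ ((111(10)^∞)_q, (1111(10)^∞)_q); (2) T_{q,0}^{−2}((01(10)^∞)_q) + 1 ∈ ((1(10)^∞)_q, (11(10)^∞)_q); (3) T_{q,0}^{−j}((01(10)^∞)_q) + 1 ∈ (((10)^∞)_q, (1(10)^∞)_q) for all j ≥ 3; (4) T_{q,0}^{−1}((011(10)^∞)_q) + 1 ∈ ((1111(10)^∞)_q, (11111(10)^∞)_q); (5) T_{q,0}^{−2}((011(10)^∞)_q) + 1 ∈ ((1(10)^∞)_q, (11(10)^∞)_q); (6)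 T_{q,0}^{−j}((011(10)^∞)_q) + 1 ∈ (((10)^∞)_q, (1(10)^∞)_q) for all j ≥ 3; (7) T_{q,0}^{−1}((100(01)^∞)_q) + 1 ∈ ((111(10)^∞)_q, (1111(10)^∞)_q); (8) T_{q,0}^{−2}((100(01)^∞)_q) + 1 ∈ ((1(10)^∞)_q, (11(10)^∞)_q); (9) T_{q,0}^{−j}((100(01)^∞)_q) + 1 ∈ (((10)^∞)_q, (1(10)^∞)_q) for all j ≥ 3; (10) T_{q,0}^{−1}((10(01)^∞)_q) + 1 ∈ ((1111(10)^∞)_q, (11111(10)^∞)_q); (11) T_{q,0}^{−2}((10(01)^∞)_q) + 1 ∈ ((1(10)^∞)_q, (11(10)^∞)_q); (12) T_{q,0}^{−j}((10(01)^∞)_q) + 1 ∈ (((10)^∞)_q, (1(10)^∞)_q) for all j ≥ 3. -/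
noncomputable section

open Set

lemma summable_seqVal {q : ℝ} (hq : 1 < q) (ε : ℕ → Fin 2) :
    Summable fun i : ℕ => ((ε i : ℕ) : ℝ) / q ^ (i + 1) := by
  have hq0 : 0 < q := by linarith
  have hgeom : Summable fun i : ℕ => q⁻¹ ^ (i + 1) :=
    (summable_nat_add_iff 1).2
      (summable_geometric_of_lt_one (by positivity) (inv_lt_one_of_one_lt₀ hq))
  refine hgeom.of_nonneg_of_le (fun i => by positivity) fun i => ?_
  have hle : ((ε i : ℕ) : ℝ) ≤ 1 := by exact_mod_cast Fin.is_le (ε i)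
  rw [inv_pow, ← one_div]
  gcongr

lemma seqVal_eq_head_add_tail {q : ℝ} (hq : 1 < q) (ε : ℕ → Fin 2) :
    seqVal q ε = (((ε 0 : ℕ) : ℝ) + seqVal q fun i => ε (i + 1)) / q := by
  unfold seqVal
  rw [(summable_seqVal hq ε).tsum_eq_zero_add, add_div, ← tsum_div_const]
  congr 1
  · simp
  · refine tsum_congr fun i => ?_
    rw [div_div, ← pow_succ]

lemma uwInf_nil_self (w : List (Fin 2)) : uwInf w w = uwInf [] w := by
  funext i
  by_cases h : i < w.length
  · simp [uwInf, h, Nat.mod_eq_of_lt h]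
  · simp [uwInf, h, ← Nat.mod_eq_sub_mod (not_lt.1 h)]

lemma seqVal_uwInf_cons {q : ℝ} (hq : 1 < q) (d : Fin 2) (u w : List (Fin 2)) :
    seqVal q (uwInf (d :: u) w) = (((d : ℕ) : ℝ) + seqVal q (uwInf u w)) / q := by
  rw [seqVal_eq_head_add_tail hq]
  congr 3
  funext i
  simp [uwInf]

lemma seqVal_uwInf_nil_one_zero {q : ℝ} (hq : 1 < q) :
    seqVal q (uwInf [] [1, 0]) = q / (q ^ 2 - 1) := by
  have h : seqVal q (uwInf [] [1, 0]) = (1 + (0 + seqVal q (uwInf [] [1, 0])) / q) / q := by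
    conv_lhs => rw [← uwInf_nil_self, seqVal_uwInf_cons hq, seqVal_uwInf_cons hq]
    simp
  have hq0 : q ≠ 0 := by linarith
  have hq2 : q ^ 2 - 1 ≠ 0 := by nlinarith
  rw [eq_div_iff hq2]
  field_simp at h
  linarith

lemma seqVal_uwInf_nil_zero_one {q : ℝ} (hq : 1 < q) :
    seqVal q (uwInf [] [0, 1]) = 1 / (q ^ 2 - 1) := by
  have h : seqVal q (uwInf [] [0, 1]) = (0 + (1 + seqVal q (uwInf [] [0, 1])) / q) / q := by
    conv_lhs => rw [← uwInf_nil_self, seqVal_uwInf_cons hq, seqVal_uwInf_cons hq]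
    simp
  have hq0 : q ≠ 0 := by linarith
  have hq2 : q ^ 2 - 1 ≠ 0 := by nlinarith
  rw [eq_div_iff hq2]
  field_simp at h
  linarith

lemma add_one_lt_sq_of_goldenRatio_lt {q : ℝ} (hq : (1 + Real.sqrt 5) / 2 < q) :
    q + 1 < q ^ 2 := by
  have h5 : Real.sqrt 5 ^ 2 = 5 := Real.sq_sqrt (by norm_num)
  nlinarith [Real.sqrt_nonneg 5]

lemma pow_six_lt_of_lt_root {q r : ℝ} (hq : 0 < q) (hqr : q < r)
    (hr : r ^ 6 = r ^ 4 + r ^ 3 + 2 * r ^ 2 + r + 1) :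
    q ^ 6 < q ^ 4 + q ^ 3 + 2 * q ^ 2 + q + 1 := by
  have hr0 : 0 < r := hq.trans hqr
  have key (k m : ℕ) : q ^ m * q ^ k * r ^ k ≤ r ^ m * q ^ k * r ^ k := by gcongr
  have h6 : q ^ 6 < r ^ 6 := by gcongr
  have h : q ^ 6 * r ^ 6 < (q ^ 4 + q ^ 3 + 2 * q ^ 2 + q + 1) * r ^ 6 := by
    calc q ^ 6 * r ^ 6 = q ^ 6 * (r ^ 4 + r ^ 3 + 2 * r ^ 2 + r + 1) := by rw [hr]
      _ < (q ^ 4 + q ^ 3 + 2 * q ^ 2 + q + 1) * r ^ 6 := by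
        linarith [key 4 2, key 3 3, key 2 4, key 1 5]
  exact lt_of_mul_lt_mul_right h (by positivity)

lemma div_pow_le_div_pow_of_le {q x : ℝ} {j k : ℕ} (hq : 1 < q) (hx : 0 ≤ x) (hjk : k ≤ j) :
    x / q ^ j ≤ x / q ^ k := by
  have hq0 : 0 < q := by linarith
  gcongr
  exact hq.le

lemma lt_of_sub_eq_div {x y n d : ℝ} (h : y - x = n / d) (hn : 0 < n) (hd : 0 < d) : x < y :=
  sub_pos.1 (h ▸ div_pos hn hd)

/-- Twelve inequalities, valid for all `q ∈ ((1+√5)/2, q_{ℵ₀})`, locating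
`T_{q,0}^{-j}(y) + 1 = y/q^j + 1` for `y` among the four special points of `J_q`. -/
theorem twelve_inequalities
    (qA : ℝ) (hqA1 : qA ∈ Set.Ioo (1 : ℝ) 2)
    (hqA2 : qA ^ 6 = qA ^ 4 + qA ^ 3 + 2 * qA ^ 2 + qA + 1)
    (q : ℝ) (hq : q ∈ Set.Ioo ((1 + Real.sqrt 5) / 2) qA) :
    (seqVal q (uwInf [0, 1] [1, 0]) / q ^ 1 + 1 ∈
      Set.Ioo (seqVal q (uwInf [1, 1, 1] [1, 0])) (seqVal q (uwInf [1, 1, 1, 1] [1, 0]))) ∧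
    (seqVal q (uwInf [0, 1] [1, 0]) / q ^ 2 + 1 ∈
      Set.Ioo (seqVal q (uwInf [1] [1, 0])) (seqVal q (uwInf [1, 1] [1, 0]))) ∧
    (∀ j : ℕ, 3 ≤ j → seqVal q (uwInf [0, 1] [1, 0]) / q ^ j + 1 ∈
      Set.Ioo (seqVal q (uwInf [] [1, 0])) (seqVal q (uwInf [1] [1, 0]))) ∧
    (seqVal q (uwInf [0, 1, 1] [1, 0]) / q ^ 1 + 1 ∈
      Set.Ioo (seqVal q (uwInf [1, 1, 1, 1] [1, 0])) (seqVal q (uwInf [1, 1, 1, 1, 1] [1, 0]))) ∧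
    (seqVal q (uwInf [0, 1, 1] [1, 0]) / q ^ 2 + 1 ∈
      Set.Ioo (seqVal q (uwInf [1] [1, 0])) (seqVal q (uwInf [1, 1] [1, 0]))) ∧
    (∀ j : ℕ, 3 ≤ j → seqVal q (uwInf [0, 1, 1] [1, 0]) / q ^ j + 1 ∈
      Set.Ioo (seqVal q (uwInf [] [1, 0])) (seqVal q (uwInf [1] [1, 0]))) ∧
    (seqVal q (uwInf [1, 0, 0] [0, 1]) / q ^ 1 + 1 ∈
      Set.Ioo (seqVal q (uwInf [1, 1, 1] [1, 0])) (seqVal q (uwInf [1, 1, 1, 1] [1, 0]))) ∧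
    (seqVal q (uwInf [1, 0, 0] [0, 1]) / q ^ 2 + 1 ∈
      Set.Ioo (seqVal q (uwInf [1] [1, 0])) (seqVal q (uwInf [1, 1] [1, 0]))) ∧
    (∀ j : ℕ, 3 ≤ j → seqVal q (uwInf [1, 0, 0] [0, 1]) / q ^ j + 1 ∈
      Set.Ioo (seqVal q (uwInf [] [1, 0])) (seqVal q (uwInf [1] [1, 0]))) ∧
    (seqVal q (uwInf [1, 0] [0, 1]) / q ^ 1 + 1 ∈
      Set.Ioo (seqVal q (uwInf [1, 1, 1, 1] [1, 0])) (seqVal q (uwInf [1, 1, 1, 1, 1] [1, 0]))) ∧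
    (seqVal q (uwInf [1, 0] [0, 1]) / q ^ 2 + 1 ∈
      Set.Ioo (seqVal q (uwInf [1] [1, 0])) (seqVal q (uwInf [1, 1] [1, 0]))) ∧
    (∀ j : ℕ, 3 ≤ j → seqVal q (uwInf [1, 0] [0, 1]) / q ^ j + 1 ∈
      Set.Ioo (seqVal q (uwInf [] [1, 0])) (seqVal q (uwInf [1] [1, 0]))) := by
  obtain ⟨hq_gold, hq_lt⟩ := hq
  have hq1 : 1 < q := by
    nlinarith [Real.sqrt_nonneg 5, Real.sq_sqrt (show (0 : ℝ) ≤ 5 by norm_num)]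
  have hq0 : 0 < q := by linarith
  have h2 : q + 1 < q ^ 2 := add_one_lt_sq_of_goldenRatio_lt hq_gold
  have h3 : 2 * q + 1 < q ^ 3 := by nlinarith
  have h4 : 2 * q ^ 2 + q < q ^ 4 := by nlinarith
  have h5 : 2 * q ^ 3 + q ^ 2 < q ^ 5 := by nlinarith
  have h6 := pow_six_lt_of_lt_root hq0 hq_lt hqA2
  have hD : 0 < q ^ 2 - 1 := by linarith
  have hm : 0 < q - 1 := by linarith
  have hA := seqVal_uwInf_nil_one_zero hq1
  have hB := seqVal_uwInf_nil_zero_one hq1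
  simp only [seqVal_uwInf_cons hq1, hA, hB, Fin.val_zero, Fin.val_one, Nat.cast_zero,
    Nat.cast_one]
  set A : ℝ := q / (q ^ 2 - 1) with hA_def
  set B : ℝ := 1 / (q ^ 2 - 1) with hB_def
  set y₁ : ℝ := (0 + (1 + A) / q) / q with hy₁
  set y₂ : ℝ := (0 + (1 + (1 + A) / q) / q) / q with hy₂
  set y₃ : ℝ := (1 + (0 + (0 + B) / q) / q) / q with hy₃
  set y₄ : ℝ := (1 + (0 + B) / q) / q with hy₄
  have hA0 : 0 < A := by positivity
  have hy₁0 : 0 < y₁ := by positivity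
  have hA1 : A < 1 := by rw [hA_def, div_lt_one hD]; linarith
  have h12 : y₁ < y₂ := by
    refine lt_of_sub_eq_div (n := q - 1) (d := q ^ 3 * (q ^ 2 - 1))
      ?_ (by linarith) (by positivity)
    simp only [hy₁, hy₂, hA_def]
    field_simp
    ring
  have h13 : y₁ < y₃ := by
    refine lt_of_sub_eq_div (n := q ^ 2 - q - 1) (d := q ^ 3)
      ?_ (by linarith) (by positivity)
    simp only [hy₁, hy₃, hA_def, hB_def]
    field_simp
    ring
  have h24 : y₂ < y₄ := by
    refine lt_of_sub_eq_div (n := q ^ 2 - q - 1) (d := q ^ 3)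
      ?_ (by linarith) (by positivity)
    simp only [hy₂, hy₄, hA_def, hB_def]
    field_simp
    ring
  have h34 : y₃ < y₄ := by
    refine lt_of_sub_eq_div (n := q - 1) (d := q ^ 3 * (q ^ 2 - 1))
      ?_ (by linarith) (by positivity)
    simp only [hy₃, hy₄, hB_def]
    field_simp
    ring
  have h₁_lower : (1 + (1 + (1 + A) / q) / q) / q < y₁ / q ^ 1 + 1 := by
    refine lt_of_sub_eq_div (n := q ^ 2 - q - 1) (d := q ^ 2)
      ?_ (by linarith) (by positivity)
    simp only [hy₁, hA_def]
    field_simp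
    ring
  have h₂_lower : (1 + (1 + (1 + (1 + A) / q) / q) / q) / q < y₂ / q ^ 1 + 1 := by
    refine lt_of_sub_eq_div (n := q ^ 2 - q - 1) (d := q ^ 2)
      ?_ (by linarith) (by positivity)
    simp only [hy₂, hA_def]
    field_simp
    ring
  have h₃_upper : y₃ / q ^ 1 + 1 < (1 + (1 + (1 + (1 + A) / q) / q) / q) / q := by
    refine lt_of_sub_eq_div (n := (q - 1) * (2 + 2 * q + q ^ 2 + q ^ 3 - q ^ 5))
      (d := q ^ 4 * (q ^ 2 - 1))
      ?_ (mul_pos hm (by nlinarith)) (by positivity)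
    simp only [hy₃, hA_def, hB_def]
    field_simp
    ring
  have h₄_upper : y₄ / q ^ 1 + 1 < (1 + (1 + (1 + (1 + (1 + A) / q) / q) / q) / q) / q := by
    refine lt_of_sub_eq_div (n := (q - 1) * (q ^ 4 + q ^ 3 + 2 * q ^ 2 + q + 1 - q ^ 6))
      (d := q ^ 5 * (q ^ 2 - 1))
      ?_ (mul_pos hm (by linarith)) (by positivity)
    simp only [hy₄, hA_def, hB_def]
    field_simp
    ring
  have h₁_sq_lower : (1 + A) / q < y₁ / q ^ 2 + 1 := by
    refine lt_of_sub_eq_div (n := (q - 1) * (1 - q ^ 2 - 2 * q ^ 3 + q ^ 5))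
      (d := q ^ 4 * (q ^ 2 - 1))
      ?_ (mul_pos hm (by linarith)) (by positivity)
    simp only [hy₁, hA_def]
    field_simp
    ring
  have h₄_sq_upper : y₄ / q ^ 2 + 1 < (1 + (1 + A) / q) / q := by
    refine lt_of_sub_eq_div (n := (q - 1) * (1 + q ^ 2 + 2 * q ^ 3 - q ^ 5))
      (d := q ^ 4 * (q ^ 2 - 1))
      ?_ (mul_pos hm (by nlinarith)) (by positivity)
    simp only [hy₄, hA_def, hB_def]
    field_simp
    ring
  have h₄_cube_upper : y₄ / q ^ 3 + 1 < (1 + A) / q := by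
    refine lt_of_sub_eq_div (n := (q - 1) * (1 + q ^ 3 + 2 * q ^ 4 - q ^ 6))
      (d := q ^ 5 * (q ^ 2 - 1))
      ?_ (mul_pos hm (by linarith)) (by positivity)
    simp only [hy₄, hA_def, hB_def]
    field_simp
    ring
  clear_value y₁ y₂ y₃ y₄ A B
  have mono {x y : ℝ} (j : ℕ) (hxy : x < y) : x / q ^ j < y / q ^ j := by gcongr
  have tail {y : ℝ} (hy0 : 0 < y) (hy : y ≤ y₄) (j : ℕ) (hj : 3 ≤ j) :
      y / q ^ j + 1 ∈ Ioo A ((1 + A) / q) := by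
    have hpos : 0 < y / q ^ j := by positivity
    have hle := div_pow_le_div_pow_of_le hq1 hy0.le hj
    have hle4 : y / q ^ 3 ≤ y₄ / q ^ 3 := by gcongr
    exact ⟨by linarith, by linarith⟩
  have square {y : ℝ} (hy1 : y₁ ≤ y) (hy4 : y ≤ y₄) :
      y / q ^ 2 + 1 ∈ Ioo ((1 + A) / q) ((1 + (1 + A) / q) / q) := by
    have hge : y₁ / q ^ 2 ≤ y / q ^ 2 := by gcongr
    have hle : y / q ^ 2 ≤ y₄ / q ^ 2 := by gcongr
    exact ⟨by linarith, by linarith⟩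
  have h13_div := mono 1 h13
  have h24_div := mono 1 h24
  have h14 := h12.trans h24
  refine ⟨⟨h₁_lower, by linarith⟩, square le_rfl h14.le, tail hy₁0 h14.le,
    ⟨h₂_lower, by linarith⟩, square h12.le h24.le, tail (hy₁0.trans h12) h24.le,
    ⟨by linarith, h₃_upper⟩, square h13.le h34.le, tail (hy₁0.trans h13) h34.le,
    ⟨by linarith, h₄_upper⟩, square h14.le le_rfl, tail (hy₁0.trans h14) le_rfl⟩
end
end
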